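/- arXiv:2303.13259 — 4 statements merged into one kernel-verified Lean document; each statement's English description precedes it below -/
import Mathlib

section
/- Let g be a smooth metric on ℝ^n whose matrix g(x) is invertible at every point, with pointwise inverse g^{··}. Let Γ0_{kij} = ½(∂_i g_{jk} + ∂_j g_{ik} − ∂_k g_{ij}) and Γ0^m_{ij} = Σ_l g^{ml} Γ0_{lij}. Let N_{ijk} : ℝ^n → ℝ be a smooth (0,3)-tensor field satisfying N_{ijk} = ε·N_{jik} for a fixed sign ε ∈ {−1, +1}. Define two connections by Γ^m_{ij} = Γ0^m_{ij} + Σ_l g^{ml} N_{lij} and Γ⋆^m_{ij} = Γ0^m_{ij} − Σ_l g^{ml} N_{lij}. Then, with lowered curvature R_{ijkl}(Γ) := Σ_m g_{im} R(Γ)^m_{jkl}, for all indices i,j,k,l at every point: R_{ijkl}(Γ) + R_{jikl}(Γ⋆) = (1 − ε)·(∇0_k N_{ijl} − ∇0_l N_{ijk}). -/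
noncomputable section
open scoped BigOperators

/-- The `i`-th partial derivative of `f : ℝⁿ → ℝ` at `x`. -/
def pd {n : ℕ} (i : Fin n) (f : EuclideanSpace ℝ (Fin n) → ℝ)
    (x : EuclideanSpace ℝ (Fin n)) : ℝ :=
  fderiv ℝ f x (EuclideanSpace.single i 1)

/-- Lowered Levi-Civita (Koszul) coefficients Γ0_{kij}. -/
def LC {n : ℕ} (g : EuclideanSpace ℝ (Fin n) → Fin n → Fin n → ℝ)
    (k i j : Fin n) (x : EuclideanSpace ℝ (Fin n)) : ℝ :=
  (pd i (fun y => g y j k) x + pd j (fun y => g y i k) x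
    - pd k (fun y => g y i j) x) / 2

/-- Riemann curvature tensor R(Γ)^m_{ijk} of a connection given by
coefficients `Γ m i j = Γ^m_{ij}`. -/
def Riem {n : ℕ} (Γ : Fin n → Fin n → Fin n → EuclideanSpace ℝ (Fin n) → ℝ)
    (m i j k : Fin n) (x : EuclideanSpace ℝ (Fin n)) : ℝ :=
  pd j (Γ m i k) x - pd k (Γ m i j) x
    + ∑ l, (Γ m l j x * Γ l i k x - Γ m l k x * Γ l i j x)

/-- Levi-Civita covariant derivative ∇0_k N_{ijl} of a (0,3)-tensor field `N`. -/
def covD {n : ℕ} (g ginv : EuclideanSpace ℝ (Fin n) → Fin n → Fin n → ℝ)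
    (N : Fin n → Fin n → Fin n → EuclideanSpace ℝ (Fin n) → ℝ)
    (k i j l : Fin n) (x : EuclideanSpace ℝ (Fin n)) : ℝ :=
  pd k (fun y => N i j l y) x
    - ∑ m, ((∑ c, ginv x m c * LC g c i k x) * N m j l x
          + (∑ c, ginv x m c * LC g c j k x) * N i m l x
          + (∑ c, ginv x m c * LC g c l k x) * N i j m x)

section PartialDerivatives

variable {n : ℕ} {f h : EuclideanSpace ℝ (Fin n) → ℝ} {x : EuclideanSpace ℝ (Fin n)}

lemma pd_add (i : Fin n) (hf : DifferentiableAt ℝ f x) (hh : DifferentiableAt ℝ h x) :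
    pd i (fun y => f y + h y) x = pd i f x + pd i h x := by
  simp [pd, fderiv_fun_add hf hh]

lemma pd_sub (i : Fin n) (hf : DifferentiableAt ℝ f x) (hh : DifferentiableAt ℝ h x) :
    pd i (fun y => f y - h y) x = pd i f x - pd i h x := by
  simp [pd, fderiv_fun_sub hf hh]

lemma pd_const_mul (i : Fin n) (c : ℝ) (hf : DifferentiableAt ℝ f x) :
    pd i (fun y => c * f y) x = c * pd i f x := by
  simp [pd, fderiv_const_mul hf]

lemma pd_sum_mul {ι : Type*} [Fintype ι] {u v : ι → EuclideanSpace ℝ (Fin n) → ℝ} (i : Fin n)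
    (hu : ∀ m, DifferentiableAt ℝ (u m) x) (hv : ∀ m, DifferentiableAt ℝ (v m) x) :
    pd i (fun y => ∑ m, u m y * v m y) x = ∑ m, (u m x * pd i (v m) x + pd i (u m) x * v m x) := by
  unfold pd
  rw [fderiv_fun_sum fun m _ => (hu m).fun_mul (hv m), sum_apply]
  refine Finset.sum_congr rfl fun m _ => ?_
  rw [fderiv_fun_mul (hu m) (hv m)]
  simp [mul_comm]

lemma ContDiff.pd (i : Fin n) (hf : ContDiff ℝ (⊤ : ℕ∞) f) : ContDiff ℝ (⊤ : ℕ∞) (pd i f) :=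
  (hf.fderiv_right (m := (⊤ : ℕ∞)) (by simp)).clm_apply contDiff_const

lemma pd_comm (i j : Fin n) (hf : ContDiff ℝ (⊤ : ℕ∞) f) :
    pd i (pd j f) x = pd j (pd i f) x := by
  have hd : DifferentiableAt ℝ (fderiv ℝ f) x :=
    (hf.fderiv_right (m := (⊤ : ℕ∞)) (by simp)).differentiable (by simp) x
  have key (a b : Fin n) : pd a (pd b f) x =
      fderiv ℝ (fderiv ℝ f) x (EuclideanSpace.single a 1) (EuclideanSpace.single b 1) := by
    change fderiv ℝ (fun y => fderiv ℝ f y (EuclideanSpace.single b 1)) x _ = _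
    rw [fderiv_clm_apply hd (differentiableAt_const _)]
    simp
  rw [key, key]
  refine (hf.contDiffAt.isSymmSndFDerivAt ?_).eq _ _
  rw [minSmoothness_of_isRCLikeNormedField]
  exact WithTop.coe_le_coe.2 (le_top : (2 : ℕ∞) ≤ ⊤)

end PartialDerivatives

section InverseMatrix

variable {E : Type*} [NormedAddCommGroup E] [NormedSpace ℝ E] {n : ℕ}

lemma differentiable_det {A : E → Matrix (Fin n) (Fin n) ℝ}
    (hA : ∀ i j, Differentiable ℝ fun x => A x i j) : Differentiable ℝ fun x => (A x).det := by
  simp only [Matrix.det_apply']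
  refine Differentiable.fun_sum fun σ _ => Differentiable.const_mul ?_ _
  exact fun x =>
    (HasFDerivAt.finsetProd fun i _ => (hA (σ i) i x).hasFDerivAt).differentiableAt

lemma differentiable_matrix_inv {A : E → Matrix (Fin n) (Fin n) ℝ}
    (hA : ∀ i j, Differentiable ℝ fun x => A x i j) (hdet : ∀ x, (A x).det ≠ 0) (i j : Fin n) :
    Differentiable ℝ fun x => (A x)⁻¹ i j := by
  simp only [Matrix.inv_def, Ring.inverse_eq_inv', Matrix.smul_apply, smul_eq_mul,
    Matrix.adjugate_apply]
  refine ((differentiable_det hA).fun_inv hdet).mul (differentiable_det fun a b => ?_)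
  by_cases h : a = j
  · subst h; simp
  · simpa [Matrix.updateRow_ne h] using hA a b

end InverseMatrix

section Curvature

variable {n : ℕ} {g : EuclideanSpace ℝ (Fin n) → Fin n → Fin n → ℝ}

lemma LC_swap (hg : ∀ x j k, g x j k = g x k j) (k i j : Fin n) (x : EuclideanSpace ℝ (Fin n)) :
    LC g k i j x = LC g k j i x := by
  simp only [LC, hg _ j i]
  ring

lemma LC_add_LC (hg : ∀ x j k, g x j k = g x k j) (i j k : Fin n)
    (x : EuclideanSpace ℝ (Fin n)) :
    LC g i j k x + LC g j i k x = pd k (fun y => g y i j) x := by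
  simp only [LC, hg _ k i, hg _ k j, hg _ j i]
  ring

lemma ContDiff.LC (hg : ∀ j k, ContDiff ℝ (⊤ : ℕ∞) fun x => g x j k) (k i j : Fin n) :
    ContDiff ℝ (⊤ : ℕ∞) (LC g k i j) :=
  ((((hg j k).pd i).add ((hg i k).pd j)).sub ((hg i j).pd k)).div_const 2

/-- Lowered curvature in terms of the lowered connection coefficients `G`. -/
lemma sum_mul_Riem {Γ G : Fin n → Fin n → Fin n → EuclideanSpace ℝ (Fin n) → ℝ}
    (hg : ∀ j k, Differentiable ℝ fun x => g x j k) (hΓ : ∀ m i j, Differentiable ℝ (Γ m i j))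
    (hG : ∀ i j k x, ∑ m, g x i m * Γ m j k x = G i j k x)
    (i j k l : Fin n) (x : EuclideanSpace ℝ (Fin n)) :
    ∑ m, g x i m * Riem Γ m j k l x = pd k (G i j l) x - pd l (G i j k) x
      + (∑ m, (G i m k x - pd k (fun y => g y i m) x) * Γ m j l x
        - ∑ m, (G i m l x - pd l (fun y => g y i m) x) * Γ m j k x) := by
  have hpd (a b : Fin n) : pd a (G i j b) x =
      ∑ m, (g x i m * pd a (Γ m j b) x + pd a (fun y => g y i m) x * Γ m j b x) := by
    rw [← pd_sum_mul a (fun m => hg i m x) fun m => hΓ m j b x]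
    exact congrArg (pd a · x) (funext fun y => (hG i j b y).symm)
  have hquad (a b : Fin n) : ∑ m, g x i m * ∑ c, Γ m c a x * Γ c j b x =
      ∑ m, G i m a x * Γ m j b x := by
    simp only [← hG, Finset.mul_sum, Finset.sum_mul]
    rw [Finset.sum_comm]
    simp only [mul_assoc]
  simp only [Riem, Finset.sum_sub_distrib, mul_add, mul_sub, Finset.sum_add_distrib, hquad, hpd,
    sub_mul]
  ring

end Curvature

theorem statement1 {n : ℕ}
    (g ginv : EuclideanSpace ℝ (Fin n) → Fin n → Fin n → ℝ)
    (hg_smooth : ∀ j k, ContDiff ℝ (⊤ : ℕ∞) (fun x => g x j k))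
    (hg_symm : ∀ x j k, g x j k = g x k j)
    -- g(x) is invertible at every point with pointwise inverse ginv
    (hinv : ∀ x i j, ∑ k, g x i k * ginv x k j = if i = j then (1:ℝ) else 0)
    (hinv' : ∀ x i j, ∑ k, ginv x i k * g x k j = if i = j then (1:ℝ) else 0)
    -- smooth (0,3)-tensor field N with N_{ijk} = ε·N_{jik}
    (N : Fin n → Fin n → Fin n → EuclideanSpace ℝ (Fin n) → ℝ)
    (hN_smooth : ∀ i j k, ContDiff ℝ (⊤ : ℕ∞) (fun x => N i j k x))
    (ε : ℝ) (hε : ε = -1 ∨ ε = 1)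
    (hNsym : ∀ i j k x, N i j k x = ε * N j i k x)
    -- the two connections Γ = Γ0 + g⁻¹N and Γ⋆ = Γ0 - g⁻¹N
    (Γ0u Γ Γs : Fin n → Fin n → Fin n → EuclideanSpace ℝ (Fin n) → ℝ)
    (hΓ0u : ∀ m i j x, Γ0u m i j x = ∑ l, ginv x m l * LC g l i j x)
    (hΓ : ∀ m i j x, Γ m i j x = Γ0u m i j x + ∑ l, ginv x m l * N l i j x)
    (hΓs : ∀ m i j x, Γs m i j x = Γ0u m i j x - ∑ l, ginv x m l * N l i j x) :
    ∀ i j k l x,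
      (∑ m, g x i m * Riem Γ m j k l x) + (∑ m, g x j m * Riem Γs m i k l x)
        = (1 - ε) * (covD g ginv N k i j l x - covD g ginv N l i j k x) := by
  intro i j k l x
  have hεε : ε * ε = 1 := by rcases hε with rfl | rfl <;> norm_num
  have hmul (y) : Matrix.of (g y) * Matrix.of (ginv y) = 1 := by
    ext a b
    simp [Matrix.mul_apply, hinv, Matrix.one_apply]
  have hginv (y) : (Matrix.of (g y))⁻¹ = Matrix.of (ginv y) := Matrix.inv_eq_right_inv (hmul y)
  have hg_diff (a b) : Differentiable ℝ fun y => g y a b := (hg_smooth a b).differentiable (by simp)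
  have hN_diff (a b c) : Differentiable ℝ (N a b c) := (hN_smooth a b c).differentiable (by simp)
  have hL_diff (a b c) : Differentiable ℝ (LC g a b c) :=
    (ContDiff.LC hg_smooth a b c).differentiable (by simp)
  have hginv_diff (a b) : Differentiable ℝ fun y => ginv y a b := by
    have h := differentiable_matrix_inv (A := fun y => Matrix.of (g y)) hg_diff
      (fun y => Matrix.det_ne_zero_of_right_inverse (hmul y)) a b
    simpa only [hginv, Matrix.of_apply] using h
  have hginv_symm (a b) : ginv x a b = ginv x b a := by
    have hT : (Matrix.of (g x)).transpose = Matrix.of (g x) := by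
      ext a b
      exact hg_symm x b a
    have h := Matrix.transpose_nonsing_inv (Matrix.of (g x))
    rw [hT, hginv] at h
    exact congrFun (congrFun h b) a
  have hlower (y) (v : Fin n → ℝ) (a : Fin n) : ∑ m, g y a m * ∑ c, ginv y m c * v c = v a := by
    simp only [Finset.mul_sum, ← mul_assoc]
    rw [Finset.sum_comm]
    simp [← Finset.sum_mul, hinv]
  have hΓ' (m a b y) : Γ m a b y = ∑ c, ginv y m c * (LC g c a b y + N c a b y) := by
    simp only [hΓ, hΓ0u, mul_add, Finset.sum_add_distrib]
  have hΓs' (m a b y) : Γs m a b y = ∑ c, ginv y m c * (LC g c a b y - N c a b y) := by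
    simp only [hΓs, hΓ0u, mul_sub, Finset.sum_sub_distrib]
  have hΓ_diff (m a b) : Differentiable ℝ (Γ m a b) := by
    rw [funext (hΓ' m a b)]
    fun_prop
  have hΓs_diff (m a b) : Differentiable ℝ (Γs m a b) := by
    rw [funext (hΓs' m a b)]
    fun_prop
  rw [sum_mul_Riem hg_diff hΓ_diff (G := fun a b c y => LC g a b c y + N a b c y)
      (fun a b c y => by simp only [hΓ', hlower y fun d => LC g d b c y + N d b c y]),
    sum_mul_Riem hg_diff hΓs_diff (G := fun a b c y => LC g a b c y - N a b c y)
      (fun a b c y => by simp only [hΓs', hlower y fun d => LC g d b c y - N d b c y])]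
  simp only [pd_add _ (hL_diff _ _ _ x) (hN_diff _ _ _ x),
    pd_sub _ (hL_diff _ _ _ x) (hN_diff _ _ _ x)]
  have hN_pd (a) (b) : pd a (N j i b) x = ε * pd a (N i j b) x := by
    rw [← pd_const_mul a ε (hN_diff i j b x)]
    exact congrArg (pd a · x) (funext fun y => hNsym j i b y)
  have hL_pd (a) (b) :
      pd a (LC g i j b) x + pd a (LC g j i b) x = pd a (pd b fun y => g y i j) x := by
    rw [← pd_add a (hL_diff _ _ _ x) (hL_diff _ _ _ x)]
    exact congrArg (pd a · x) (funext fun y => LC_add_LC hg_symm i j b y)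
  have hcomm := pd_comm (x := x) k l (hg_smooth i j)
  -- The inner product of covectors at `x`.
  obtain ⟨B, hB⟩ : ∃ B : (Fin n → ℝ) → (Fin n → ℝ) → ℝ,
      ∀ u v, B u v = ∑ m, u m * ∑ c, ginv x m c * v c := ⟨_, fun _ _ => rfl⟩
  have hB_symm (u v) : B u v = B v u := by
    simp only [hB, Finset.mul_sum]
    rw [Finset.sum_comm]
    refine Finset.sum_congr rfl fun a _ => Finset.sum_congr rfl fun b _ => ?_
    rw [hginv_symm b a]
    ring
  let L (a b : Fin n) : Fin n → ℝ := fun c => LC g c a b x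
  let M (a b : Fin n) : Fin n → ℝ := fun c => N c a b x
  have hquad (a b c d) : ∑ m, (LC g a m b x + N a m b x - pd b (fun y => g y a m) x) * Γ m c d x =
      ε * B (M a b) (L c d) + ε * B (M a b) (M c d) - B (L a b) (L c d) - B (L a b) (M c d) := by
    simp only [hB, hΓ', ← LC_add_LC hg_symm, hNsym a, L, M, mul_add, Finset.mul_sum,
      ← Finset.sum_add_distrib, ← Finset.sum_sub_distrib]
    refine Finset.sum_congr rfl fun _ _ => Finset.sum_congr rfl fun _ _ => ?_
    ring
  have hquads (a b c d) :
      ∑ m, (LC g a m b x - N a m b x - pd b (fun y => g y a m) x) * Γs m c d x =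
      ε * B (M a b) (M c d) - ε * B (M a b) (L c d) - B (L a b) (L c d) + B (L a b) (M c d) := by
    simp only [hB, hΓs', ← LC_add_LC hg_symm, hNsym a, L, M, mul_sub, Finset.mul_sum,
      ← Finset.sum_add_distrib, ← Finset.sum_sub_distrib]
    refine Finset.sum_congr rfl fun _ _ => Finset.sum_congr rfl fun _ _ => ?_
    ring
  have hcov (a b) : covD g ginv N a i j b x = pd a (N i j b) x - (B (M j b) (L i a)
      + ε * B (M i b) (L j a) + ∑ m, (∑ c, ginv x m c * LC g c b a x) * N i j m x) := by
    simp only [covD, hB, L, M, Finset.sum_add_distrib, fun m => hNsym i m b x, Finset.mul_sum, Finset.sum_mul]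
    congr 4
    all_goals
      funext m
      congr! 1
      ring
  rw [hquad, hquad, hquads, hquads, hcov, hcov, hN_pd, hN_pd]
  simp only [LC_swap hg_symm _ l k]
  rw [hB_symm (M i k) (M j l), hB_symm (M i l) (M j k), hB_symm (L i k) (L j l),
    hB_symm (L i l) (L j k), hB_symm (L i k) (M j l), hB_symm (L i l) (M j k), hB_symm (L j k) (M i l),
    hB_symm (L j l) (M i k)]
  linear_combination hL_pd k l - hL_pd l k + hcomm
    + (B (M i k) (L j l) - B (M i l) (L j k)) * hεε
end
end

section
/- Let Γ1, Γ2 be connection coefficient fields on ℝ^n that are differentiable at a point x, and set K^l_{ij} = Γ1^l_{ij} − Γ2^l_{ij}. Define the mutual curvature tensor of Γ1 and Γ2 by M^m_{kij} := ½(∂_i Γ1^m_{kj} − ∂_j Γ1^m_{ki}) + ½(∂_i Γ2^m_{kj} − ∂_j Γ2^m_{ki}) + ½ Σ_l (Γ2^l_{kj} Γ1^m_{li} − Γ2^l_{ki} Γ1^m_{lj}) + ½ Σ_l (Γ1^l_{kj} Γ2^m_{li} − Γ1^l_{ki} Γ2^m_{lj}). Then at x, for all m,k,i,j: M^m_{kij}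 = ½(R(Γ1)^m_{kij} + R(Γ2)^m_{kij}) + ½ Σ_l (K^l_{ki} K^m_{lj} − K^l_{kj} K^m_{li}), where R(Γ)^m_{kij} = ∂_i Γ^m_{kj} − ∂_j Γ^m_{ki} + Σ_l (Γ^m_{li} Γ^l_{kj} − Γ^m_{lj} Γ^l_{ki}) is the Riemann tensor of a single connection. -/
noncomputable section
open scoped BigOperators

theorem statement9 {n : ℕ}
    (Γ1 Γ2 : Fin n → Fin n → Fin n → EuclideanSpace ℝ (Fin n) → ℝ)
    (x : EuclideanSpace ℝ (Fin n))
    (hΓ1 : ∀ m i j, DifferentiableAt ℝ (Γ1 m i j) x)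
    (hΓ2 : ∀ m i j, DifferentiableAt ℝ (Γ2 m i j) x)
    -- difference tensor K^l_{ij} = Γ1^l_{ij} − Γ2^l_{ij}
    (K : Fin n → Fin n → Fin n → EuclideanSpace ℝ (Fin n) → ℝ)
    (hK : ∀ l i j y, K l i j y = Γ1 l i j y - Γ2 l i j y)
    -- the mutual curvature tensor of Γ1 and Γ2
    (M : Fin n → Fin n → Fin n → Fin n → EuclideanSpace ℝ (Fin n) → ℝ)
    (hM : ∀ m k i j, M m k i j x =
      (pd i (Γ1 m k j) x - pd j (Γ1 m k i) x) / 2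
      + (pd i (Γ2 m k j) x - pd j (Γ2 m k i) x) / 2
      + (∑ l, (Γ2 l k j x * Γ1 m l i x - Γ2 l k i x * Γ1 m l j x)) / 2
      + (∑ l, (Γ1 l k j x * Γ2 m l i x - Γ1 l k i x * Γ2 m l j x)) / 2) :
    ∀ m k i j, M m k i j x
      = (Riem Γ1 m k i j x + Riem Γ2 m k i j x) / 2
        + (∑ l, (K l k i x * K m l j x - K l k j x * K m l i x)) / 2 := by
  intro m k i j
  have h_sum : (∑ l, (Γ2 l k j x * Γ1 m l i x - Γ2 l k i x * Γ1 m l j x))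
      + ∑ l, (Γ1 l k j x * Γ2 m l i x - Γ1 l k i x * Γ2 m l j x)
      = (∑ l, (Γ1 m l i x * Γ1 l k j x - Γ1 m l j x * Γ1 l k i x))
      + (∑ l, (Γ2 m l i x * Γ2 l k j x - Γ2 m l j x * Γ2 l k i x))
      + ∑ l, (K l k i x * K m l j x - K l k j x * K m l i x) := by
    simp only [← Finset.sum_add_distrib, hK]
    exact Finset.sum_congr rfl fun l _ => by ring
  rw [hM, Riem, Riem]
  linarith
end
end

section
/- Let Γ1, Γ2 be connection coefficient fields on ℝ^n that are differentiable at a point x, and let t ∈ ℝ. Set Γ^k_{ij} = t·Γ1^k_{ij} + (1−t)·Γ2^k_{ij} and K^k_{ij} = Γ1^k_{ij} − Γ2^k_{ij}. Then at x, for all m,i,j,k: R(Γ)^m_{ijk} = t·R(Γ1)^m_{ijk} + (1−t)·R(Γ2)^m_{ijk} − t(1−t)·Σ_l (K^m_{lj} K^l_{ik} − K^m_{lk} K^l_{ij}). -/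
noncomputable section
open scoped BigOperators

theorem pd_linear_combination {n : ℕ} {a b : ℝ} {f g h : EuclideanSpace ℝ (Fin n) → ℝ}
    (hf : ∀ y, f y = a * g y + b * h y) {x : EuclideanSpace ℝ (Fin n)}
    (hg : DifferentiableAt ℝ g x) (hh : DifferentiableAt ℝ h x) (i : Fin n) :
    pd i f x = a * pd i g x + b * pd i h x := by
  have hderiv : HasFDerivAt f (a • fderiv ℝ g x + b • fderiv ℝ h x) x := by
    rw [funext hf]
    exact (hg.hasFDerivAt.const_mul a).add (hh.hasFDerivAt.const_mul b)
  simp [pd, hderiv.fderiv]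

theorem statement10 {n : ℕ}
    (Γ1 Γ2 : Fin n → Fin n → Fin n → EuclideanSpace ℝ (Fin n) → ℝ)
    (x : EuclideanSpace ℝ (Fin n))
    (hΓ1 : ∀ m i j, DifferentiableAt ℝ (Γ1 m i j) x)
    (hΓ2 : ∀ m i j, DifferentiableAt ℝ (Γ2 m i j) x)
    (t : ℝ)
    -- the convex linear combination Γ = t·Γ1 + (1−t)·Γ2
    (Γ : Fin n → Fin n → Fin n → EuclideanSpace ℝ (Fin n) → ℝ)
    (hΓ : ∀ k i j y, Γ k i j y = t * Γ1 k i j y + (1 - t) * Γ2 k i j y)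
    -- difference tensor K = Γ1 − Γ2
    (K : Fin n → Fin n → Fin n → EuclideanSpace ℝ (Fin n) → ℝ)
    (hK : ∀ k i j y, K k i j y = Γ1 k i j y - Γ2 k i j y) :
    ∀ m i j k, Riem Γ m i j k x
      = t * Riem Γ1 m i j k x + (1 - t) * Riem Γ2 m i j k x
        - t * (1 - t) * ∑ l, (K m l j x * K l i k x - K m l k x * K l i j x) := by
  intro m i j k
  simp only [Riem, pd_linear_combination (hΓ _ _ _) (hΓ1 _ _ _) (hΓ2 _ _ _), hΓ, hK]
  have hquad : ∑ l, ((t * Γ1 m l j x + (1 - t) * Γ2 m l j x)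
          * (t * Γ1 l i k x + (1 - t) * Γ2 l i k x)
        - (t * Γ1 m l k x + (1 - t) * Γ2 m l k x)
          * (t * Γ1 l i j x + (1 - t) * Γ2 l i j x))
      = ∑ l, t * (Γ1 m l j x * Γ1 l i k x - Γ1 m l k x * Γ1 l i j x)
        + ∑ l, (1 - t) * (Γ2 m l j x * Γ2 l i k x - Γ2 m l k x * Γ2 l i j x)
        - ∑ l, t * (1 - t) * ((Γ1 m l j x - Γ2 m l j x) * (Γ1 l i k x - Γ2 l i k x)
          - (Γ1 m l k x - Γ2 m l k x) * (Γ1 l i j x - Γ2 l i j x)) := by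
    rw [← Finset.sum_add_distrib, ← Finset.sum_sub_distrib]
    exact Finset.sum_congr rfl fun l _ => by ring
  simp only [← Finset.mul_sum] at hquad
  rw [hquad]
  ring
end
end

section
/- Let n ≥ 1, let g : Fin n → Fin n → ℝ be a symmetric matrix (g_{nm} = g_{mn}), and let N : Fin n → Fin n → Fin n → ℝ satisfy N_{ijk} = ε·N_{jik} for all i,j,k, for a fixed ε ∈ {−1, +1}. Writing N^n_{jl} := Σ_m g_{nm} N_{mjl} for the index raised with g, one has for all i,j,k,l: Σ_n ( N_{ink} N^n_{jl} − N_{inl} N^n_{jk} + N_{jnk} N^n_{il} − N_{jnl} N^n_{ik} ) = 0. -/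
open scoped BigOperators

/-- Contracting two arrays that are (anti)symmetric in their first pair of indices against a
symmetric matrix gives an expression invariant under exchanging the two factors. -/
theorem sum_mul_raise_comm {ι κ R : Type*} [Fintype ι] [CommRing R]
    (g : ι → ι → R) (hg : ∀ a b, g a b = g b a) (N : ι → ι → κ → R)
    (ε : R) (hε : ε * ε = 1) (hN : ∀ i j k, N i j k = ε * N j i k) (i j : ι) (k l : κ) :
    ∑ m, N i m k * (∑ p, g m p * N p j l) = ∑ m, N j m l * (∑ p, g m p * N p i k) := by
  simp only [Finset.mul_sum]
  rw [Finset.sum_comm]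
  refine Finset.sum_congr rfl fun p _ => Finset.sum_congr rfl fun m _ => ?_
  rw [hN i m k, hN p j l, hg m p]
  linear_combination (N m i k * g p m * N j p l) * hε

theorem statement14 {n : ℕ} (hn : 1 ≤ n)
    (g : Fin n → Fin n → ℝ)
    (hg_symm : ∀ m l, g m l = g l m)
    (N : Fin n → Fin n → Fin n → ℝ)
    (ε : ℝ) (hε : ε = -1 ∨ ε = 1)
    (hNsym : ∀ i j k, N i j k = ε * N j i k) :
    -- with index raised via g: N^n_{jl} = Σ_m g_{nm} N_{mjl}
    ∀ i j k l,
      ∑ m, (N i m k * (∑ p, g m p * N p j l)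
          - N i m l * (∑ p, g m p * N p j k)
          + N j m k * (∑ p, g m p * N p i l)
          - N j m l * (∑ p, g m p * N p i k)) = 0 := by
  intro i j k l
  have hεε : ε * ε = 1 := by rcases hε with rfl | rfl <;> norm_num
  simp only [Finset.sum_add_distrib, Finset.sum_sub_distrib]
  rw [sum_mul_raise_comm g hg_symm N ε hεε hNsym i j k l,
    sum_mul_raise_comm g hg_symm N ε hεε hNsym i j l k]
  ring
end
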